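/- arXiv:2405.03629 — 2 statements merged into one kernel-verified Lean document; each statement's English description precedes it below -/
import Mathlib

section
/- (Proposition 1.) Assume the vertex representation: for every y ∈ ℝ^m with E y ≤ 0, X(y) equals the convex hull of {V_1 y, …, V_v y}. Let (y_t)_{t ∈ ℕ} be a sequence in ℝ^m such that for every t ∈ ℕ there exists u_t ∈ ℝ^{v·nu} with (y_t, u_t, y_{t+1}) ∈ 𝕊. Then (X(y_t))_{t ∈ ℕ} is a robust forward invariant tube: for every t ∈ ℕ and every x ∈ X(y_t), there exists u ∈ 𝒰 such that A x + B u + w ∈ X(y_{t+1}) for every (A,B) ∈ Δ and every w ∈ 𝒲. -/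
open Matrix

/-- The constraint set `𝕊` of tube parameters `(y, u, y⁺)`. -/
def Sset {n nu m p v q : ℕ}
    (A : Fin p → Matrix (Fin n) (Fin n) ℝ)
    (B : Fin p → Matrix (Fin n) (Fin nu) ℝ)
    (SX : Set (Fin n → ℝ)) (SU : Set (Fin nu → ℝ))
    (F : Matrix (Fin m) (Fin n) ℝ)
    (E : Matrix (Fin q) (Fin m) ℝ)
    (V : Fin v → Matrix (Fin n) (Fin m) ℝ)
    (U : Fin v → Matrix (Fin nu) (Fin (v * nu)) ℝ)
    (d : Fin m → ℝ) :
    Set ((Fin m → ℝ) × (Fin (v * nu) → ℝ) × (Fin m → ℝ)) :=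
  {s | (∀ (i : Fin p) (j : Fin v),
        F.mulVec ((A i).mulVec ((V j).mulVec s.1) + (B i).mulVec ((U j).mulVec s.2.1)) + d
          ≤ s.2.2)
    ∧ E.mulVec s.1 ≤ 0
    ∧ (∀ j : Fin v, (V j).mulVec s.1 ∈ SX)
    ∧ (∀ j : Fin v, (U j).mulVec s.2.1 ∈ SU)}

/-- The multiplicative-uncertainty set `Δ = convh {(A₁,B₁),…,(A_p,B_p)}`. -/
def Delta {n nu p : ℕ}
    (A : Fin p → Matrix (Fin n) (Fin n) ℝ)
    (B : Fin p → Matrix (Fin n) (Fin nu) ℝ) :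
    Set (Matrix (Fin n) (Fin n) ℝ × Matrix (Fin n) (Fin nu) ℝ) :=
  {AB | ∃ θ : Fin p → ℝ, (∀ i, 0 ≤ θ i) ∧ (∑ i, θ i) = 1 ∧
    AB.1 = ∑ i, θ i • A i ∧ AB.2 = ∑ i, θ i • B i}

/-- The parametric polytope `X(y) = {x : F x ≤ y}`. -/
def Xset {n m : ℕ} (F : Matrix (Fin m) (Fin n) ℝ) (y : Fin m → ℝ) : Set (Fin n → ℝ) :=
  {x | F.mulVec x ≤ y}

theorem convex_Xset {n m : ℕ} (F : Matrix (Fin m) (Fin n) ℝ) (y : Fin m → ℝ) :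
    Convex ℝ (Xset F y) :=
  (convex_Iic y).linear_preimage F.mulVecLin

theorem mem_Xset_sub_iff {n m : ℕ} {F : Matrix (Fin m) (Fin n) ℝ} {y d : Fin m → ℝ}
    {x : Fin n → ℝ} : x ∈ Xset F (y - d) ↔ F.mulVec x + d ≤ y := by
  change F.mulVec x ≤ y - d ↔ _
  exact le_sub_iff_add_le

/-- Membership of successor states at the generating pairs extends to all of `Delta`. -/
theorem mulVec_add_mulVec_mem_of_mem_Delta {n nu p : ℕ}
    {A : Fin p → Matrix (Fin n) (Fin n) ℝ} {B : Fin p → Matrix (Fin n) (Fin nu) ℝ}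
    {C : Set (Fin n → ℝ)} (hC : Convex ℝ C) {x : Fin n → ℝ} {u : Fin nu → ℝ}
    (h : ∀ i, (A i).mulVec x + (B i).mulVec u ∈ C)
    {AB : Matrix (Fin n) (Fin n) ℝ × Matrix (Fin n) (Fin nu) ℝ} (hAB : AB ∈ Delta A B) :
    AB.1.mulVec x + AB.2.mulVec u ∈ C := by
  obtain ⟨θ, hθ, hsum, hA, hB⟩ := hAB
  have key := hC.sum_mem (fun i _ => hθ i) hsum (fun i _ => h i)
  simpa only [hA, hB, Matrix.sum_mulVec, Matrix.smul_mulVec, smul_add,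
    Finset.sum_add_distrib] using key

/-- The state-input pairs with admissible input whose nominal successors, at every generating
pair, lie in `C` form a convex set. -/
theorem convex_setOf_mulVec_add_mulVec_mem {n nu p : ℕ}
    (A : Fin p → Matrix (Fin n) (Fin n) ℝ) (B : Fin p → Matrix (Fin n) (Fin nu) ℝ)
    {C : Set (Fin n → ℝ)} (hC : Convex ℝ C) {SU : Set (Fin nu → ℝ)} (hSU : Convex ℝ SU) :
    Convex ℝ {z : (Fin n → ℝ) × (Fin nu → ℝ) |
      z.2 ∈ SU ∧ ∀ i, (A i).mulVec z.1 + (B i).mulVec z.2 ∈ C} := by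
  rw [Set.ofPred_and, Set.ofPred_forall]
  exact (hSU.linear_preimage (LinearMap.snd ℝ _ _)).inter <| convex_iInter fun i =>
    hC.linear_preimage ((A i).mulVecLin.coprod (B i).mulVecLin)

/-- **Proposition 1.** Under the vertex representation of configuration-constrained
polytopes, any sequence `(y_t)` admitting vertex inputs with `(y_t, u_t, y_{t+1}) ∈ 𝕊` generates a
robust forward invariant tube `(X(y_t))`. -/
theorem configuration_constrained_RFIT
    {n nu m p v q : ℕ}
    (A : Fin p → Matrix (Fin n) (Fin n) ℝ)
    (B : Fin p → Matrix (Fin n) (Fin nu) ℝ)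
    (W SX : Set (Fin n → ℝ)) (SU : Set (Fin nu → ℝ))
    (hW : Convex ℝ W) (hSX : Convex ℝ SX) (hSU : Convex ℝ SU)
    (F : Matrix (Fin m) (Fin n) ℝ)
    (E : Matrix (Fin q) (Fin m) ℝ)
    (V : Fin v → Matrix (Fin n) (Fin m) ℝ)
    (U : Fin v → Matrix (Fin nu) (Fin (v * nu)) ℝ)
    (d : Fin m → ℝ)
    (hd : ∀ w ∈ W, F.mulVec w ≤ d)
    (hvert : ∀ y : Fin m → ℝ, E.mulVec y ≤ 0 →
      Xset F y = convexHull ℝ (Set.range fun j : Fin v => (V j).mulVec y))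
    (y : ℕ → Fin m → ℝ)
    (hy : ∀ t : ℕ, ∃ u : Fin (v * nu) → ℝ, (y t, u, y (t + 1)) ∈ Sset A B SX SU F E V U d) :
    ∀ t : ℕ, ∀ x ∈ Xset F (y t), ∃ ux ∈ SU,
      ∀ AB ∈ Delta A B, ∀ w ∈ W,
        AB.1.mulVec x + AB.2.mulVec ux + w ∈ Xset F (y (t + 1)) := by
  intro t x hx
  obtain ⟨u, hF, hE, -, hU⟩ := hy t
  rw [hvert _ hE] at hx
  have hC := convex_Xset F (y (t + 1) - d)
  have hfst := (convex_setOf_mulVec_add_mulVec_mem A B hC hSU).linear_image (LinearMap.fst ℝ _ _)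
  obtain ⟨⟨x', ux⟩, ⟨hux, hz⟩, rfl⟩ := convexHull_min (by
    rintro _ ⟨j, rfl⟩
    exact ⟨((V j).mulVec (y t), (U j).mulVec u),
      ⟨hU j, fun i => mem_Xset_sub_iff.2 (hF i j)⟩, rfl⟩) hfst hx
  refine ⟨ux, hux, fun AB hAB w hw => ?_⟩
  have hnom := mem_Xset_sub_iff.1 (mulVec_add_mulVec_mem_of_mem_Delta hC hz hAB)
  change F.mulVec (_ + w) ≤ _
  rw [Matrix.mulVec_add]
  exact (add_le_add_right (hd w hw) _).trans hnom
end

section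
/- (Inequality (10) of the paper.) Let γ ∈ [0,1] and let P be a symmetric positive-semidefinite (m + v·nu)×(m + v·nu) real matrix. Suppose (y_s, u_s, y_s) ∈ 𝕊 and (ȳ, ū, γ·ȳ + (1−γ)·y_s) ∈ 𝕊, and set ȳ⁺ := γ·ȳ + (1−γ)·y_s. Then M(ȳ⁺, y_s, u_s) ≤ γ² · ‖(ȳ − y_s, ū − u_s)‖_P². -/
open Matrix
open scoped ENNReal

/-- Terminal cost `M(y, y_s, u_s)`, an infimum taken in `[0, +∞]` (equal to `+∞` when the
feasible set is empty). -/
noncomputable def Mterm {m k : ℕ} (γ : ℝ)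
    (S : Set ((Fin m → ℝ) × (Fin k → ℝ) × (Fin m → ℝ)))
    (P : Matrix (Fin m ⊕ Fin k) (Fin m ⊕ Fin k) ℝ)
    (y ys : Fin m → ℝ) (us : Fin k → ℝ) : ℝ≥0∞ :=
  ⨅ (u : Fin k → ℝ) (_ : (y, u, γ • y + (1 - γ) • ys) ∈ S),
    ENNReal.ofReal
      (Sum.elim (y - ys) (u - us) ⬝ᵥ P.mulVec (Sum.elim (y - ys) (u - us)))

/-- Cost-to-travel `V(y, y⁺, y_s, u_s)`, an infimum taken in `[0, +∞]` (equal to `+∞` when the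
feasible set is empty). -/
noncomputable def Vtravel {m k : ℕ}
    (S : Set ((Fin m → ℝ) × (Fin k → ℝ) × (Fin m → ℝ)))
    (Q : Matrix (Fin m ⊕ Fin k) (Fin m ⊕ Fin k) ℝ)
    (y yp ys : Fin m → ℝ) (us : Fin k → ℝ) : ℝ≥0∞ :=
  ⨅ (u : Fin k → ℝ) (_ : (y, u, yp) ∈ S),
    ENNReal.ofReal
      (Sum.elim (y - ys) (u - us) ⬝ᵥ Q.mulVec (Sum.elim (y - ys) (u - us)))

/-- The constraint set `𝕊` is convex when the state and input constraint sets are. -/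
theorem convex_Sset {n nu m p v q : ℕ}
    (A : Fin p → Matrix (Fin n) (Fin n) ℝ)
    (B : Fin p → Matrix (Fin n) (Fin nu) ℝ)
    {SX : Set (Fin n → ℝ)} {SU : Set (Fin nu → ℝ)}
    (hSX : Convex ℝ SX) (hSU : Convex ℝ SU)
    (F : Matrix (Fin m) (Fin n) ℝ)
    (E : Matrix (Fin q) (Fin m) ℝ)
    (V : Fin v → Matrix (Fin n) (Fin m) ℝ)
    (U : Fin v → Matrix (Fin nu) (Fin (v * nu)) ℝ)
    (d : Fin m → ℝ) :
    Convex ℝ (Sset A B SX SU F E V U d) := by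
  rintro ⟨y, u, y'⟩ ⟨hF, hE, hV, hU⟩ ⟨z, w, z'⟩ ⟨gF, gE, gV, gU⟩ a b ha hb hab
  refine ⟨fun i j => ?_, ?_, fun j => ?_, fun j => ?_⟩
  · have hsum := add_le_add (smul_le_smul_of_nonneg_left (hF i j) ha)
      (smul_le_smul_of_nonneg_left (gF i j) hb)
    refine le_trans (le_of_eq ?_) hsum
    have hd : d = a • d + b • d := by rw [← add_smul, hab, one_smul]
    conv_lhs => rw [hd]
    simp only [Prod.smul_mk, Prod.mk_add_mk, mulVec_add, mulVec_smul, smul_add]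
    abel
  · have hsum := add_le_add (smul_le_smul_of_nonneg_left hE ha)
      (smul_le_smul_of_nonneg_left gE hb)
    simpa [mulVec_add, mulVec_smul] using hsum
  · simpa [mulVec_add, mulVec_smul] using hSX (hV j) (gV j) ha hb hab
  · simpa [mulVec_add, mulVec_smul] using hSU (hU j) (gU j) ha hb hab

/-- **inequality (10).** Under the stated feasibility conditions and with
`ȳ⁺ = γȳ + (1−γ)y_s`, one has `M(ȳ⁺, y_s, u_s) ≤ γ²·‖(ȳ − y_s, ū − u_s)‖_P²`. -/
theorem Mterm_contraction
    {n nu m p v q : ℕ}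
    (A : Fin p → Matrix (Fin n) (Fin n) ℝ)
    (B : Fin p → Matrix (Fin n) (Fin nu) ℝ)
    (W SX : Set (Fin n → ℝ)) (SU : Set (Fin nu → ℝ))
    (hW : Convex ℝ W) (hSX : Convex ℝ SX) (hSU : Convex ℝ SU)
    (F : Matrix (Fin m) (Fin n) ℝ)
    (E : Matrix (Fin q) (Fin m) ℝ)
    (V : Fin v → Matrix (Fin n) (Fin m) ℝ)
    (U : Fin v → Matrix (Fin nu) (Fin (v * nu)) ℝ)
    (d : Fin m → ℝ)
    (hd : ∀ w ∈ W, F.mulVec w ≤ d)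
    (γ : ℝ) (hγ0 : 0 ≤ γ) (hγ1 : γ ≤ 1)
    (P : Matrix (Fin m ⊕ Fin (v * nu)) (Fin m ⊕ Fin (v * nu)) ℝ)
    (hPsymm : P.IsSymm)
    (hPpsd : ∀ z : Fin m ⊕ Fin (v * nu) → ℝ, 0 ≤ z ⬝ᵥ P.mulVec z)
    (ys : Fin m → ℝ) (us : Fin (v * nu) → ℝ)
    (hys : (ys, us, ys) ∈ Sset A B SX SU F E V U d)
    (yb : Fin m → ℝ) (ub : Fin (v * nu) → ℝ)
    (hyb : (yb, ub, γ • yb + (1 - γ) • ys) ∈ Sset A B SX SU F E V U d) :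
    Mterm γ (Sset A B SX SU F E V U d) P (γ • yb + (1 - γ) • ys) ys us
      ≤ ENNReal.ofReal (γ ^ 2 *
          (Sum.elim (yb - ys) (ub - us) ⬝ᵥ P.mulVec (Sum.elim (yb - ys) (ub - us)))) := by
  have hmem := convex_Sset A B hSX hSU F E V U d hyb hys hγ0 (sub_nonneg.2 hγ1)
    (add_sub_cancel γ 1)
  refine (iInf₂_le (γ • ub + (1 - γ) • us) hmem).trans (le_of_eq ?_)
  have hdiff : Sum.elim (γ • yb + (1 - γ) • ys - ys) (γ • ub + (1 - γ) • us - us)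
      = γ • Sum.elim (yb - ys) (ub - us) := by
    ext (i | i) <;> simp <;> ring
  rw [hdiff, mulVec_smul, smul_dotProduct, dotProduct_smul, smul_eq_mul, smul_eq_mul,
    ← mul_assoc, ← sq]
end
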